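/- For every n ≥ 1, the number of Dyck (n+1)-paths that end with DD, contain no occurrence of the word DUDU, and contain no contiguous substring of the form U U Q D D with Q a nonempty Dyck path, equals the Motzkin number M_n. -/

import Mathlib

namespace Paper

/-- A step of a lattice path: `true` is an upstep `U`, `false` is a downstep `D`. -/
abbrev Step := Bool

def U : Step := true
def D : Step := false

/-- `p` is a Dyck path: equally many `U`s and `D`s, and every prefix has at
least as many `U`s as `D`s. -/
def IsDyck (p : List Step) : Prop :=
  p.count U = p.count D ∧ ∀ n : ℕ, (p.take n).count D ≤ (p.take n).count U

/-- `p` is a primitive Dyck path: it is a nonempty Dyck path and every proper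
nonempty prefix has strictly more `U`s than `D`s. -/
def IsPrim (p : List Step) : Prop :=
  IsDyck p ∧ p ≠ [] ∧
    ∀ n : ℕ, 0 < n → n < p.length → (p.take n).count D < (p.take n).count U

/-- `U^i`. -/
def Us (i : ℕ) : List Step := List.replicate i U

/-- `D^i`. -/
def Ds (i : ℕ) : List Step := List.replicate i D

/-- `(UD)^i`. -/
def UDs (i : ℕ) : List Step := (List.replicate i [U, D]).flatten

/-- `p` ends with `DD`. -/
def EndsDD (p : List Step) : Prop := ∃ q, p = q ++ [D, D]

/-- The Motzkin numbers: `M 0 = 1` and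
`M (n+1) = M n + ∑_{k=0}^{n-1} M k * M (n-1-k)`. -/
def motzkin : ℕ → ℕ
  | 0 => 1
  | n + 1 =>
    motzkin n +
      ((List.range n).attach.map
        (fun k => motzkin k.1 * motzkin (n - 1 - k.1))).sum
decreasing_by
  · exact Nat.lt_succ_self n
  · have := List.mem_range.mp k.2; omega
  · have := List.mem_range.mp k.2; omega


/-- The excess of upsteps over downsteps. -/
def excess (p : List Step) : ℤ := (p.count U : ℤ) - p.count D

@[simp] lemma excess_nil : excess [] = 0 := rfl

@[simp] lemma excess_append (p q : List Step) : excess (p ++ q) = excess p + excess q := by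
  simp only [excess, List.count_append]
  push_cast
  ring

@[simp] lemma excess_cons_U (p : List Step) : excess (U :: p) = 1 + excess p := by
  simp [excess, U, D]
  ring

@[simp] lemma excess_cons_D (p : List Step) : excess (D :: p) = -1 + excess p := by
  simp [excess, U, D]
  ring

lemma isDyck_iff {p : List Step} :
    IsDyck p ↔ excess p = 0 ∧ ∀ a b, p = a ++ b → 0 ≤ excess a := by
  unfold IsDyck excess
  refine and_congr (by omega) ⟨fun h a b hp => ?_, fun h n => ?_⟩
  · have := h a.length
    rw [hp, List.take_left] at this
    omega
  · have := h (p.take n) (p.drop n) (List.take_append_drop n p).symm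
    omega

lemma isDyck_nil : IsDyck [] := by simp [IsDyck]

lemma IsDyck.append {p q : List Step} (hp : IsDyck p) (hq : IsDyck q) : IsDyck (p ++ q) := by
  rw [isDyck_iff] at *
  refine ⟨by simp [hp.1, hq.1], fun a b h => ?_⟩
  obtain ⟨c, rfl, h2⟩ | ⟨c, h1, -⟩ := List.append_eq_append_iff.mp h
  · simpa [hp.1] using hq.2 _ _ h2
  · exact hp.2 _ _ h1

/-- Every nonempty proper prefix of the elevation of a Dyck path has positive excess. -/
lemma IsDyck.excess_prefix_pos {w a b : List Step} (hw : IsDyck w)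
    (h : U :: (w ++ [D]) = a ++ b) (ha : a ≠ []) (hb : b ≠ []) : 0 < excess a := by
  obtain ⟨x, a, rfl⟩ := List.exists_cons_of_ne_nil ha
  obtain ⟨b, y, rfl⟩ := (List.eq_nil_or_concat' _).resolve_left hb
  rw [List.cons_append] at h
  obtain ⟨rfl, h⟩ := List.cons_eq_cons.mp h
  have h : w ++ [D] = a ++ b ++ [y] := by simpa using h
  have := (isDyck_iff.mp hw).2 _ _ (List.append_inj_left' h rfl)
  simp
  omega

lemma IsDyck.elevate {w : List Step} (hw : IsDyck w) : IsDyck (U :: (w ++ [D])) := by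
  refine isDyck_iff.mpr ⟨by simp [(isDyck_iff.mp hw).1], fun a b h => ?_⟩
  rcases eq_or_ne a [] with rfl | ha
  · simp
  rcases eq_or_ne b [] with rfl | hb
  · rw [List.append_nil] at h
    simp [← h, (isDyck_iff.mp hw).1]
  · exact (hw.excess_prefix_pos h ha hb).le

lemma IsDyck.not_cons_D {p : List Step} : ¬ IsDyck (D :: p) := fun h => by
  have := (isDyck_iff.mp h).2 [D] p rfl
  simp at this

lemma IsDyck.not_append_U {p : List Step} : ¬ IsDyck (p ++ [U]) := fun h => by
  have h1 := (isDyck_iff.mp h).2 p [U] rfl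
  have h2 := (isDyck_iff.mp h).1
  simp at h2
  omega

/-- An elevated Dyck path that is a factor of `s ++ U :: (w ++ [D])` is a factor of `s`, a factor
of `w`, or the last component. -/
lemma elevate_infix_cases {s w q A B : List Step} (hw : IsDyck w) (hq : IsDyck q)
    (h : A ++ (U :: (q ++ [D]) ++ B) = s ++ U :: (w ++ [D])) :
    U :: (q ++ [D]) <:+: s ∨ U :: (q ++ [D]) <:+: w ∨ q = w := by
  have hwe := (isDyck_iff.mp hw).1
  have hqe := (isDyck_iff.mp hq).1
  have key : ∀ c, U :: (w ++ [D]) = c ++ (U :: (q ++ [D]) ++ B) →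
      U :: (q ++ [D]) <:+: w ∨ q = w := by
    intro c hc
    rcases List.eq_nil_or_concat' B with rfl | ⟨B, y, rfl⟩
    · rcases eq_or_ne c [] with rfl | hcn
      · right
        simpa using hc.symm
      · rw [List.append_nil] at hc
        have h1 := hw.excess_prefix_pos hc hcn (by simp)
        have h2 := congrArg excess hc
        simp only [excess_cons_U, excess_append, hwe, hqe, excess_cons_D, excess_nil] at h2
        omega
    · rcases c with _ | ⟨x, c⟩
      · have h1 := hw.excess_prefix_pos (a := U :: (q ++ [D])) hc (by simp) (by simp)
        simp [hqe] at h1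
      · left
        refine ⟨c, B, ?_⟩
        rw [List.cons_append, ← List.append_assoc, ← List.append_assoc] at hc
        have := List.append_inj_left' (List.cons_eq_cons.mp hc).2 rfl
        rw [this, List.append_assoc]
  obtain ⟨c, rfl, h2⟩ | ⟨c, rfl, h2⟩ := List.append_eq_append_iff.mp h
  · obtain ⟨e, rfl, -⟩ | ⟨e, he, h4⟩ := List.append_eq_append_iff.mp h2
    · exact .inl ⟨A, e, by simp⟩
    · rcases eq_or_ne e [] with rfl | hen
      · exact .inl ⟨A, [], by simp [he]⟩
      rcases eq_or_ne c [] with rfl | hcn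
      · exact .inr (key [] h2.symm)
      have h5 := hq.excess_prefix_pos he hcn hen
      have h6 := (isDyck_iff.mp hw.elevate).2 _ _ h4
      have h7 := congrArg excess he
      simp only [excess_cons_U, excess_append, hqe, excess_cons_D, excess_nil] at h7
      omega
  · exact .inr (key c h2)

/-- The Dyck path coded by a binary tree through the last return decomposition. -/
def word : BinaryTree Unit → List Step
  | .nil => []
  | .node _ s w => word s ++ U :: (word w ++ [D])

lemma isDyck_word (t : BinaryTree Unit) : IsDyck (word t) := by
  induction t with
  | nil => exact isDyck_nil
  | node _ s w hs hw => exact hs.append hw.elevate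

@[simp] lemma excess_word (t : BinaryTree Unit) : excess (word t) = 0 :=
  (isDyck_iff.mp (isDyck_word t)).1

lemma count_word (t : BinaryTree Unit) : (word t).count U = t.numNodes := by
  induction t with
  | nil => rfl
  | node _ s w hs hw =>
    have : List.count U [D] = 0 := rfl
    simp only [word, List.count_append, List.count_cons_self, hs, hw, this, BinaryTree.numNodes]
    omega

lemma word_eq_nil {t : BinaryTree Unit} : word t = [] ↔ t = .nil := by
  cases t <;> simp [word]

lemma append_elevate_inj {s w s' w' : List Step} (hs : IsDyck s) (hw : IsDyck w)
    (hs' : IsDyck s') (hw' : IsDyck w')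
    (h : s ++ U :: (w ++ [D]) = s' ++ U :: (w' ++ [D])) : s = s' ∧ w = w' := by
  rw [isDyck_iff] at hs hs'
  have key : ∀ {v v' c : List Step}, IsDyck v → excess c = 0 →
      U :: (v ++ [D]) = c ++ U :: (v' ++ [D]) → c = [] := by
    intro v v' c hv hc h
    by_contra hn
    have := hv.excess_prefix_pos h hn (by simp)
    omega
  have hc : s = s' := by
    obtain ⟨c, rfl, h2⟩ | ⟨c, rfl, h2⟩ := List.append_eq_append_iff.mp h
    · rw [key hw (by simpa [hs.1] using hs'.1) h2, List.append_nil]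
    · rw [key hw' (by simpa [hs'.1] using hs.1) h2, List.append_nil]
  subst hc
  simpa using h

lemma word_injective : Function.Injective word := by
  intro t
  induction t with
  | nil => exact fun t' h => (word_eq_nil.mp h.symm).symm
  | node _ s w hs hw =>
    intro t' h
    cases t' with
    | nil => simp [word] at h
    | node _ s' w' =>
      obtain ⟨h1, h2⟩ := append_elevate_inj (isDyck_word s) (isDyck_word w) (isDyck_word s')
        (isDyck_word w') h
      rw [hs h1, hw h2]

/-- The nonnegative path `word tₖ U ⋯ U word t₁ U word t` coded by `t` and the stack
`[t₁, …, tₖ]`. -/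
def stackWord (t : BinaryTree Unit) : List (BinaryTree Unit) → List Step
  | [] => word t
  | t' :: r => stackWord t' r ++ U :: word t

@[simp] lemma excess_stackWord (t : BinaryTree Unit) (r : List (BinaryTree Unit)) :
    excess (stackWord t r) = r.length := by
  induction r generalizing t with
  | nil => simp [stackWord]
  | cons t' r ih => simp [stackWord, ih]

lemma exists_stackWord {p : List Step} (hp : ∀ a b, p = a ++ b → 0 ≤ excess a) :
    ∃ t r, p = stackWord t r := by
  induction p using List.reverseRecOn with
  | nil => exact ⟨.nil, [], rfl⟩
  | append_singleton p x ih =>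
    obtain ⟨t, r, rfl⟩ := ih fun a b h => hp a (b ++ [x]) (by rw [h, List.append_assoc])
    cases x with
    | true => exact ⟨.nil, t :: r, rfl⟩
    | false =>
      cases r with
      | nil =>
        have := hp _ [] (List.append_nil _).symm
        change 0 ≤ excess (_ ++ [D]) at this
        simp at this
      | cons t' r =>
        refine ⟨.node () t' t, r, ?_⟩
        change stackWord t' r ++ U :: word t ++ [D] = _
        cases r <;> simp [stackWord, word]

lemma IsDyck.exists_word {p : List Step} (hp : IsDyck p) : ∃ t, word t = p := by
  rw [isDyck_iff] at hp
  obtain ⟨t, r, rfl⟩ := exists_stackWord hp.2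
  have := hp.1
  rw [excess_stackWord, Nat.cast_eq_zero, List.length_eq_zero_iff] at this
  exact ⟨t, by rw [this, stackWord]⟩

lemma word_not_append_U {t : BinaryTree Unit} {a : List Step} : word t ≠ a ++ [U] :=
  fun h => IsDyck.not_append_U (h ▸ isDyck_word t)

lemma word_not_cons_D {t : BinaryTree Unit} {a : List Step} : word t ≠ D :: a :=
  fun h => IsDyck.not_cons_D (h ▸ isDyck_word t)

lemma endsDD_word_node {s w : BinaryTree Unit} : EndsDD (word (.node () s w)) ↔ w ≠ .nil := by
  cases w with
  | nil =>
    simp only [ne_eq, not_true_eq_false, iff_false]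
    rintro ⟨q, hq⟩
    have : word s ++ [U] ++ [D] = q ++ [D] ++ [D] := by simpa [word] using hq
    simpa [U, D] using congrArg List.getLast? (List.append_inj_left' this rfl)
  | node _ x y =>
    simp only [ne_eq, reduceCtorEq, not_false_eq_true, iff_true]
    exact ⟨word s ++ U :: (word x ++ U :: word y), by simp [word]⟩

/-- `p` contains a factor `U U Q D D` with `Q` a nonempty Dyck path. -/
def HasUUQDD (p : List Step) : Prop :=
  ∃ A Q B : List Step, Q ≠ [] ∧ IsDyck Q ∧ p = A ++ [U, U] ++ Q ++ [D, D] ++ B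

lemma HasUUQDD.mono {p q : List Step} (h : p <:+: q) (hp : HasUUQDD p) : HasUUQDD q := by
  obtain ⟨a, b, rfl⟩ := h
  obtain ⟨A, Q, B, hn, hQ, rfl⟩ := hp
  exact ⟨a ++ A, Q, B ++ b, hn, hQ, by simp⟩

lemma word_infix_left (s w : BinaryTree Unit) : word s <:+: word (.node () s w) :=
  ⟨[], U :: (word w ++ [D]), rfl⟩

lemma word_infix_right (s w : BinaryTree Unit) : word w <:+: word (.node () s w) :=
  ⟨word s ++ [U], [D], by simp [word]⟩

lemma hasUUQDD_word_node {s w : BinaryTree Unit} :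
    HasUUQDD (word (.node () s w)) ↔
      HasUUQDD (word s) ∨ HasUUQDD (word w) ∨ (w.left = .nil ∧ w.right ≠ .nil) := by
  constructor
  · rintro ⟨A, Q, B, hn, hQ, h⟩
    have h' : A ++ (U :: (U :: (Q ++ [D]) ++ [D]) ++ B) = word s ++ U :: (word w ++ [D]) := by
      rw [word] at h
      simp [h]
    have of_factor : ∀ {p : List Step}, U :: (U :: (Q ++ [D]) ++ [D]) <:+: p → HasUUQDD p :=
      fun hi => HasUUQDD.mono hi ⟨[], Q, [], hn, hQ, by simp⟩
    refine (elevate_infix_cases (isDyck_word w) hQ.elevate h').imp of_factor (Or.imp of_factor ?_)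
    intro hw
    obtain ⟨x, rfl⟩ := hQ.exists_word
    have : word (.node () .nil x) = word w := hw
    rw [← word_injective this]
    exact ⟨rfl, fun hx => hn (word_eq_nil.mpr hx)⟩
  · rintro (h | h | ⟨h1, h2⟩)
    · exact h.mono (word_infix_left s w)
    · exact h.mono (word_infix_right s w)
    · cases w with
      | nil => simp at h2
      | node _ x y =>
        simp only [BinaryTree.left, BinaryTree.right] at h1 h2
        subst h1
        exact ⟨word s, word y, [], fun h => h2 (word_eq_nil.mp h), isDyck_word y, by simp [word]⟩

lemma dudu_of_word_eq_append {s : BinaryTree Unit} {A : List Step} (h : word s = A ++ [D, U, D]) :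
    s.left ≠ .nil ∧ s.right = .nil := by
  cases s with
  | nil => simp [word] at h
  | node _ x y =>
    have h1 : word x ++ U :: word y = A ++ [D] ++ [U] := by
      refine List.append_inj_left' (t₁ := [D]) (t₂ := [D]) ?_ rfl
      simpa [word] using h
    rcases List.eq_nil_or_concat' (word y) with hy | ⟨b, z, hy⟩
    · rw [hy] at h1
      have h2 := List.append_inj_left' h1 rfl
      refine ⟨fun hx => ?_, word_eq_nil.mp hy⟩
      simp only [BinaryTree.left] at hx
      simp [hx, word] at h2
    · rw [hy, ← List.cons_append, ← List.append_assoc] at h1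
      rw [List.append_inj_right' h1 rfl] at hy
      exact absurd hy word_not_append_U

lemma dudu_infix_word_node {s w : BinaryTree Unit} :
    [D, U, D, U] <:+: word (.node () s w) ↔
      [D, U, D, U] <:+: word s ∨ [D, U, D, U] <:+: word w ∨ (s.left ≠ .nil ∧ s.right = .nil) := by
  have hUD : U ≠ D := by decide
  constructor
  · rintro ⟨A, B, h⟩
    rw [word, List.append_assoc] at h
    obtain ⟨c, hs, h2⟩ | ⟨c, rfl, h2⟩ := List.append_eq_append_iff.mp h
    · rcases c with _ | ⟨c1, _ | ⟨c2, _ | ⟨c3, _ | ⟨c4, c⟩⟩⟩⟩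
      · simp [hUD.symm] at h2
      · simp only [List.cons_append, List.nil_append, List.cons.injEq] at h2
        rcases List.eq_nil_or_concat' (word w) with hw | ⟨b, z, hw⟩
        · simp [hw] at h2
        · rcases hw' : word w with _ | ⟨d, e⟩
          · simp [hw'] at hw
          · rw [hw'] at h2
            simp only [List.cons_append, List.cons.injEq] at h2
            rw [← h2.2.2.1] at hw'
            exact absurd hw' word_not_cons_D
      · simp [hUD.symm] at h2
      · simp only [List.cons_append, List.nil_append, List.cons.injEq] at h2
        obtain ⟨rfl, rfl, rfl, -⟩ := h2
        exact .inr (.inr (dudu_of_word_eq_append hs))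
      · simp only [List.cons_append, List.nil_append, List.cons.injEq] at h2
        obtain ⟨rfl, rfl, rfl, rfl, -⟩ := h2
        exact .inl ⟨A, c, by simp [hs]⟩
    · rcases c with _ | ⟨x, c⟩
      · simp [hUD] at h2
      · have h3 := (List.cons_eq_cons.mp h2).2
        rcases List.eq_nil_or_concat' B with rfl | ⟨B, y, rfl⟩
        · have : word w ++ [D] = c ++ [D, U, D] ++ [U] := by simpa using h3
          exact absurd (List.append_inj_right' this rfl) (by simp [hUD.symm])
        · refine .inr (.inl ⟨c, B, ?_⟩)
          have : word w ++ [D] = c ++ [D, U, D, U] ++ B ++ [y] := by simpa using h3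
          exact (List.append_inj_left' this rfl).symm
  · rintro (h | h | ⟨h1, h2⟩)
    · exact h.trans (word_infix_left s w)
    · exact h.trans (word_infix_right s w)
    · rcases s with _ | ⟨_, _ | ⟨_, x, y⟩, z⟩
      · simp at h1
      · simp at h1
      · simp only [BinaryTree.right] at h2
        subst h2
        exact ⟨word x ++ U :: word y, word w ++ [D], by simp [word]⟩

/-- The trees whose path avoids `DUDU` and `U U Q D D` for nonempty Dyck paths `Q`. -/
def Admissible : BinaryTree Unit → Prop
  | .nil => True
  | .node _ s w => Admissible s ∧ Admissible w ∧
      ¬ (s.left ≠ .nil ∧ s.right = .nil) ∧ ¬ (w.left = .nil ∧ w.right ≠ .nil)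

lemma admissible_iff {t : BinaryTree Unit} :
    Admissible t ↔ ¬ [D, U, D, U] <:+: word t ∧ ¬ HasUUQDD (word t) := by
  induction t with
  | nil => simp [Admissible, word, HasUUQDD]
  | node _ s w hs hw =>
    rw [Admissible, hs, hw, dudu_infix_word_node, hasUUQDD_word_node]
    tauto

/-- Nonempty admissible trees that may occur as a left subtree of an admissible tree. -/
def LeftAdmissible (t : BinaryTree Unit) : Prop :=
  t ≠ .nil ∧ Admissible t ∧ ¬ (t.left ≠ .nil ∧ t.right = .nil)

/-- Nonempty admissible trees that may occur as a right subtree of an admissible tree. -/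
def RightAdmissible (t : BinaryTree Unit) : Prop :=
  t ≠ .nil ∧ Admissible t ∧ ¬ (t.left = .nil ∧ t.right ≠ .nil)

lemma leftAdmissible_node {u : Unit} {s w : BinaryTree Unit} :
    LeftAdmissible (.node u s w) ↔
      (s = .nil ∧ w = .nil) ∨ (s = .nil ∧ RightAdmissible w) ∨
        (LeftAdmissible s ∧ RightAdmissible w) := by
  cases s <;> cases w <;> simp [LeftAdmissible, RightAdmissible, Admissible]
  tauto

lemma rightAdmissible_node {u : Unit} {s w : BinaryTree Unit} :
    RightAdmissible (.node u s w) ↔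
      (s = .nil ∧ w = .nil) ∨ (LeftAdmissible s ∧ w = .nil) ∨
        (LeftAdmissible s ∧ RightAdmissible w) := by
  cases s <;> cases w <;> simp [LeftAdmissible, RightAdmissible, Admissible]
  tauto

/-- The mirror image of a binary tree. -/
def mirror : BinaryTree Unit → BinaryTree Unit
  | .nil => .nil
  | .node _ s w => .node () (mirror w) (mirror s)

lemma mirror_involutive : Function.Involutive mirror := by
  intro t
  induction t with
  | nil => rfl
  | node _ s w hs hw => rw [mirror, mirror, hs, hw]

lemma mirror_eq_nil {t : BinaryTree Unit} : mirror t = .nil ↔ t = .nil := by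
  cases t <;> simp [mirror]

lemma numNodes_mirror (t : BinaryTree Unit) : (mirror t).numNodes = t.numNodes := by
  induction t with
  | nil => rfl
  | node _ s w hs hw => simp [mirror, hs, hw, add_comm]

lemma admissible_mirror (t : BinaryTree Unit) :
    (LeftAdmissible (mirror t) ↔ RightAdmissible t) ∧
      (RightAdmissible (mirror t) ↔ LeftAdmissible t) := by
  induction t with
  | nil => simp [mirror, LeftAdmissible, RightAdmissible]
  | node _ s w hs hw =>
    simp only [mirror, leftAdmissible_node, rightAdmissible_node, hs, hw, mirror_eq_nil]
    generalize (s = .nil) = a, (w = .nil) = b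
    tauto

open Classical in
/-- The left admissible trees with `n` nodes. -/
noncomputable def leftTrees (n : ℕ) : Finset (BinaryTree Unit) :=
  (BinaryTree.treesOfNumNodesEq n).filter LeftAdmissible

open Classical in
/-- The right admissible trees with `n` nodes. -/
noncomputable def rightTrees (n : ℕ) : Finset (BinaryTree Unit) :=
  (BinaryTree.treesOfNumNodesEq n).filter RightAdmissible

lemma mem_leftTrees {n : ℕ} {t : BinaryTree Unit} :
    t ∈ leftTrees n ↔ t.numNodes = n ∧ LeftAdmissible t := by
  simp [leftTrees]

lemma mem_rightTrees {n : ℕ} {t : BinaryTree Unit} :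
    t ∈ rightTrees n ↔ t.numNodes = n ∧ RightAdmissible t := by
  simp [rightTrees]

lemma card_rightTrees (n : ℕ) : (rightTrees n).card = (leftTrees n).card := by
  refine Finset.card_bij' (fun t _ => mirror t) (fun t _ => mirror t) ?_ ?_
    (fun t _ => mirror_involutive t) (fun t _ => mirror_involutive t)
  · intro t ht
    rw [mem_rightTrees] at ht
    rw [mem_leftTrees, numNodes_mirror, (admissible_mirror t).1]
    exact ht
  · intro t ht
    rw [mem_leftTrees] at ht
    rw [mem_rightTrees, numNodes_mirror, (admissible_mirror t).2]
    exact ht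

lemma numNodes_eq_zero {t : BinaryTree Unit} : t.numNodes = 0 ↔ t = .nil := by
  cases t <;> simp

lemma card_leftTrees_zero : (leftTrees 0).card = 0 := by
  rw [Finset.card_eq_zero, Finset.eq_empty_iff_forall_notMem]
  intro t ht
  rw [mem_leftTrees, numNodes_eq_zero] at ht
  exact ht.2.1 ht.1

lemma card_leftTrees_one : (leftTrees 1).card = 1 := by
  rw [Finset.card_eq_one]
  refine ⟨.node () .nil .nil, ?_⟩
  ext t
  rw [mem_leftTrees, Finset.mem_singleton]
  constructor
  · rintro ⟨h, -⟩
    cases t with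
    | nil => simp at h
    | node _ s w =>
      simp only [BinaryTree.numNodes] at h
      rw [numNodes_eq_zero.mp (by omega : s.numNodes = 0),
        numNodes_eq_zero.mp (by omega : w.numNodes = 0)]
  · rintro rfl
    simp [leftAdmissible_node]

lemma node_mem_pairwiseNode {a b : Finset (BinaryTree Unit)} {u : Unit}
    {s w : BinaryTree Unit} :
    .node u s w ∈ BinaryTree.pairwiseNode a b ↔ s ∈ a ∧ w ∈ b := by
  rw [Finset.mem_map]
  constructor
  · rintro ⟨⟨x, y⟩, h, hxy⟩
    obtain ⟨-, rfl, rfl⟩ := (BinaryTree.node.injEq ..).mp hxy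
    exact Finset.mem_product.mp h
  · exact fun h => ⟨(s, w), Finset.mem_product.mpr h, rfl⟩

lemma nil_notMem_pairwiseNode {a b : Finset (BinaryTree Unit)} :
    .nil ∉ BinaryTree.pairwiseNode a b := by
  simp

lemma leftTrees_add_two (n : ℕ) :
    leftTrees (n + 2) =
      BinaryTree.pairwiseNode {.nil} (rightTrees (n + 1)) ∪
        (Finset.HasAntidiagonal.antidiagonal (n + 1)).biUnion
          fun ij => BinaryTree.pairwiseNode (leftTrees ij.1) (rightTrees ij.2) := by
  ext t
  rw [Finset.mem_union, Finset.mem_biUnion]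
  cases t with
  | nil => simp only [mem_leftTrees, nil_notMem_pairwiseNode]; simp
  | node _ s w =>
    simp only [node_mem_pairwiseNode, mem_leftTrees, mem_rightTrees, leftAdmissible_node,
      BinaryTree.numNodes, Finset.mem_singleton, Prod.exists,
      Finset.HasAntidiagonal.mem_antidiagonal]
    constructor
    · rintro ⟨hn, ⟨rfl, rfl⟩ | ⟨rfl, hw⟩ | ⟨hs, hw⟩⟩
      · simp at hn
      · exact .inl ⟨rfl, by simpa using hn, hw⟩
      · exact .inr ⟨_, _, by omega, ⟨rfl, hs⟩, rfl, hw⟩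
    · rintro (⟨rfl, hn, hw⟩ | ⟨_, _, hn, ⟨rfl, hs⟩, rfl, hw⟩)
      · exact ⟨by simp [hn], by simp [hw]⟩
      · exact ⟨by omega, by simp [hs, hw]⟩

lemma card_leftTrees_add_two (n : ℕ) :
    (leftTrees (n + 2)).card =
      (leftTrees (n + 1)).card +
        ∑ ij ∈ Finset.HasAntidiagonal.antidiagonal (n + 1),
          (leftTrees ij.1).card * (leftTrees ij.2).card := by
  rw [leftTrees_add_two, Finset.card_union_of_disjoint, Finset.card_biUnion]
  · simp [card_rightTrees]
  · intro ij _ kl _ hne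
    rw [Function.onFun, Finset.disjoint_left]
    intro t h1 h2
    cases t with
    | nil => exact nil_notMem_pairwiseNode h1
    | node _ s w =>
      rw [node_mem_pairwiseNode, mem_leftTrees, mem_rightTrees] at h1 h2
      exact hne (Prod.ext (h1.1.1.symm.trans h2.1.1) (h1.2.1.symm.trans h2.2.1))
  · rw [Finset.disjoint_left]
    intro t h1 h2
    cases t with
    | nil => exact nil_notMem_pairwiseNode h1
    | node _ s w =>
      obtain ⟨ij, -, h3⟩ := Finset.mem_biUnion.mp h2
      rw [node_mem_pairwiseNode] at h1 h3
      exact (mem_leftTrees.mp h3.1).2.1 (Finset.mem_singleton.mp h1.1)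

lemma motzkin_succ (n : ℕ) :
    motzkin (n + 1) = motzkin n + ∑ k ∈ Finset.range n, motzkin k * motzkin (n - 1 - k) := by
  rw [motzkin, List.attach_map_val (f := fun k => motzkin k * motzkin (n - 1 - k)),
    ← List.sum_toFinset _ List.nodup_range, List.toFinset_range]

lemma card_leftTrees_succ (n : ℕ) : (leftTrees (n + 1)).card = motzkin n := by
  induction n using Nat.strong_induction_on with
  | _ n ih =>
    cases n with
    | zero => rw [card_leftTrees_one, motzkin]
    | succ n =>
      rw [card_leftTrees_add_two, motzkin_succ, ih n n.lt_succ_self,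
        Finset.Nat.sum_antidiagonal_eq_sum_range_succ
          (fun i j => (leftTrees i).card * (leftTrees j).card),
        Finset.sum_range_succ, Finset.sum_range_succ', card_leftTrees_zero, Nat.sub_self,
        card_leftTrees_zero]
      simp only [zero_mul, mul_zero, add_zero, Nat.add_left_cancel_iff]
      refine Finset.sum_congr rfl fun k hk => ?_
      rw [Finset.mem_range] at hk
      rw [ih k (by omega), show n + 1 - (k + 1) = n - 1 - k + 1 by omega, ih _ (by omega)]

lemma leftAdmissible_iff_endsDD {t : BinaryTree Unit} (ht : 2 ≤ t.numNodes) :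
    LeftAdmissible t ↔ EndsDD (word t) ∧ Admissible t := by
  cases t with
  | nil => simp at ht
  | node _ s w =>
    rw [endsDD_word_node]
    have : ¬ (s = .nil ∧ w = .nil) := by
      rintro ⟨rfl, rfl⟩
      simp at ht
    simp only [LeftAdmissible, BinaryTree.left, BinaryTree.right]
    simp only [ne_eq, reduceCtorEq, not_false_eq_true, true_and]
    tauto

/-- For every `n ≥ 1`, the number of Dyck `(n+1)`-paths that
end with `DD`, avoid `DUDU`, and contain no contiguous substring `U U Q D D`
with `Q` a nonempty Dyck path, is the Motzkin number `M_n`. -/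
theorem stmt_15 (n : ℕ) (hn : 1 ≤ n) :
    Nat.card {p : List Step //
      IsDyck p ∧ p.count U = n + 1 ∧ EndsDD p ∧
      (¬ [D, U, D, U] <:+: p) ∧
      ¬ ∃ A Q B : List Step, Q ≠ [] ∧ IsDyck Q ∧
          p = A ++ [U, U] ++ Q ++ [D, D] ++ B} = motzkin n := by
  rw [← card_leftTrees_succ n, ← Finset.card_map ⟨word, word_injective⟩]
  refine Nat.subtype_card _ fun p => ?_
  simp only [Finset.mem_map, Function.Embedding.coeFn_mk, mem_leftTrees]
  constructor
  · rintro ⟨t, ⟨hn', ht⟩, rfl⟩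
    obtain ⟨h1, h2⟩ := (leftAdmissible_iff_endsDD (by omega)).mp ht
    exact ⟨isDyck_word t, by rw [count_word, hn'], h1, admissible_iff.mp h2⟩
  · rintro ⟨hp, hc, h1, h2⟩
    obtain ⟨t, rfl⟩ := hp.exists_word
    rw [count_word] at hc
    exact ⟨t, ⟨hc, (leftAdmissible_iff_endsDD (by omega)).mpr ⟨h1, admissible_iff.mpr h2⟩⟩, rfl⟩

end Paper
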